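/- Suppose a probability measure μ on X^n (product of n i.i.d. copies of a measure satisfying a log Sobolev inequality with constant C on a normed space X) is given, and let f : X^n → ℝ be L-Lipschitz with L = n^{−1/max(2,p)} (with respect to the product ℓ² norm). Then P(f − E f ≥ t) ≤ exp(−n^{2/max(2,p)} t²/(2C)). In particular, for f(x) = W_p(μ̂_x, μ), P(W_p(μ̂,μ) − E W_p(μ̂,μ) ≥ t) ≤ exp(−n^{2/max(2,p)} t²/(2C)). -/

import Mathlib

open MeasureTheory
open scoped ENNReal

/-- A probability measure `μ` on a normed space satisfies a log Sobolev
inequality with constant `C` if for every smooth `f` with the relevant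
integrability, `Ent_μ(f²) ≤ 2C E_μ ‖∇f‖²` (here `‖∇f(x)‖ = ‖fderiv ℝ f x‖`). -/
def LogSobolev {E : Type*} [NormedAddCommGroup E] [NormedSpace ℝ E]
    [MeasurableSpace E] (μ : Measure E) (C : ℝ) : Prop :=
  ∀ f : E → ℝ, ContDiff ℝ (⊤ : ℕ∞) f →
    Integrable (fun x => (f x) ^ 2 * Real.log ((f x) ^ 2)) μ →
    Integrable (fun x => (f x) ^ 2) μ →
    Integrable (fun x => ‖fderiv ℝ f x‖ ^ 2) μ →
    ∫ x, (f x) ^ 2 * Real.log ((f x) ^ 2) ∂μ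
        - (∫ x, (f x) ^ 2 ∂μ) * Real.log (∫ x, (f x) ^ 2 ∂μ)
      ≤ 2 * C * ∫ x, ‖fderiv ℝ f x‖ ^ 2 ∂μ

/-- The Wasserstein distance of order `p` on a normed space. -/
noncomputable def wassersteinDist {E : Type*} [NormedAddCommGroup E] [MeasurableSpace E]
    (p : ℝ) (μ ν : Measure E) : ℝ :=
  ((⨅ ξ ∈ {ξ : Measure (E × E) | ξ.map Prod.fst = μ ∧ ξ.map Prod.snd = ν},
      ∫⁻ q, ENNReal.ofReal (‖q.1 - q.2‖ ^ p) ∂ξ) ^ (1 / p)).toReal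

/-- The empirical measure of an `n`-tuple of points: mass `1/n` at each `x i`. -/
noncomputable def empiricalMeasure {E : Type*} [MeasurableSpace E] {n : ℕ}
    (x : Fin n → E) : Measure E :=
  (n : ℝ≥0∞)⁻¹ • ∑ i, Measure.dirac (x i)


noncomputable def lse (N : ℕ) (a : ℕ → ℝ) : ℝ :=
  ((N : ℝ) + 1)⁻¹ * Real.log (∑ k ∈ Finset.range (N + 1), Real.exp (((N : ℝ) + 1) * a k))

lemma lse_sum_pos (N : ℕ) (a : ℕ → ℝ) :
    0 < ∑ k ∈ Finset.range (N + 1), Real.exp (((N : ℝ) + 1) * a k) :=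
  Finset.sum_pos (fun _ _ => Real.exp_pos _) ⟨0, by simp⟩

lemma lse_mono_add (N : ℕ) (a b : ℕ → ℝ) (c : ℝ) (h : ∀ k, a k ≤ b k + c) :
    lse N a ≤ lse N b + c := by
  unfold lse
  have hN : (0 : ℝ) < (N : ℝ) + 1 := by positivity
  have h1 : ∑ k ∈ Finset.range (N + 1), Real.exp (((N : ℝ) + 1) * a k)
      ≤ (∑ k ∈ Finset.range (N + 1), Real.exp (((N : ℝ) + 1) * b k)) *
        Real.exp (((N : ℝ) + 1) * c) := by
    rw [Finset.sum_mul]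
    refine Finset.sum_le_sum fun k _ => ?_
    rw [← Real.exp_add]
    refine Real.exp_le_exp.2 ?_
    nlinarith [h k]
  have h2 := Real.log_le_log (lse_sum_pos N a) h1
  rw [Real.log_mul (lse_sum_pos N b).ne' (Real.exp_pos _).ne', Real.log_exp] at h2
  calc _ ≤ ((N : ℝ) + 1)⁻¹ * (Real.log (∑ k ∈ Finset.range (N + 1),
            Real.exp (((N : ℝ) + 1) * b k)) + ((N : ℝ) + 1) * c) := by gcongr
    _ = _ := by field_simp

lemma lse_tendsto (a : ℕ → ℝ) (s : ℝ) (h : IsLUB (Set.range a) s) :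
    Filter.Tendsto (fun N => lse N a) Filter.atTop (nhds s) := by
  have hlog : Filter.Tendsto (fun N : ℕ => ((N : ℝ) + 1)⁻¹ * Real.log ((N : ℝ) + 1))
      Filter.atTop (nhds 0) := by
    have h1 : Filter.Tendsto (fun x : ℝ => Real.log x / x) Filter.atTop (nhds 0) := by
      simpa using (Real.isLittleO_log_id_atTop.tendsto_div_nhds_zero)
    have h2 : Filter.Tendsto (fun N : ℕ => ((N : ℝ) + 1)) Filter.atTop Filter.atTop :=
      Filter.tendsto_atTop_add_const_right _ _ tendsto_natCast_atTop_atTop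
    refine (h1.comp h2).congr fun N => ?_
    simp [div_eq_inv_mul]
  have hup : ∀ N, lse N a ≤ s + ((N : ℝ) + 1)⁻¹ * Real.log ((N : ℝ) + 1) := by
    intro N
    have := lse_mono_add N a (fun _ => 0) s (fun k => by simpa using h.1 ⟨k, rfl⟩)
    simp [lse] at this ⊢
    linarith
  rw [Metric.tendsto_atTop]
  intro ε hε
  obtain ⟨_, ⟨k, rfl⟩, hk⟩ := h.exists_between_sub_self hε
  obtain ⟨N0, hN0⟩ := (Metric.tendsto_atTop.1 hlog) ε hε
  refine ⟨max N0 k, fun N hN => ?_⟩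
  have hlow : a k ≤ lse N a := by
    unfold lse
    have hNp : (0 : ℝ) < (N : ℝ) + 1 := by positivity
    have : Real.exp (((N : ℝ) + 1) * a k) ≤
        ∑ k ∈ Finset.range (N + 1), Real.exp (((N : ℝ) + 1) * a k) :=
      Finset.single_le_sum (f := fun k => Real.exp (((N : ℝ) + 1) * a k))
        (fun _ _ => (Real.exp_pos _).le)
        (by have := le_of_max_le_right hN; simp; omega)
    have := Real.log_le_log (Real.exp_pos _) this
    rw [Real.log_exp] at this
    rw [inv_mul_eq_div, le_div_iff₀ hNp]; linarith
  have h3 := hN0 N (le_of_max_le_left hN)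
  rw [Real.dist_eq, abs_lt] at h3 ⊢
  have := hup N
  constructor <;> linarith [hk.1]

lemma lse_tendsto_args (N : ℕ) (a : ℕ → ℕ → ℝ) (b : ℕ → ℝ)
    (h : ∀ k, Filter.Tendsto (fun m => a m k) Filter.atTop (nhds (b k))) :
    Filter.Tendsto (fun m => lse N (a m)) Filter.atTop (nhds (lse N b)) := by
  unfold lse
  refine Filter.Tendsto.const_mul _ (Filter.Tendsto.log ?_ (lse_sum_pos N b).ne')
  refine tendsto_finsetSum _ fun k _ => ?_
  exact (Real.continuous_exp.tendsto _).comp ((h k).const_mul _)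

lemma lse_contDiff {V : Type*} [NormedAddCommGroup V] [NormedSpace ℝ V] (N : ℕ)
    (a : V → ℕ → ℝ) (h : ∀ k, ContDiff ℝ (⊤ : ℕ∞) (fun x => a x k)) :
    ContDiff ℝ (⊤ : ℕ∞) (fun x => lse N (a x)) := by
  unfold lse
  refine contDiff_const.mul (ContDiff.log ?_ fun x => (lse_sum_pos N (a x)).ne')
  exact ContDiff.sum fun k _ => (contDiff_const.mul (h k)).exp

lemma approx_class {V : Type*} [NormedAddCommGroup V] [NormedSpace ℝ V]
    [TopologicalSpace.SeparableSpace V] (L : ℝ) (hL : 0 ≤ L) (P : (V → ℝ) → Prop)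
    (hlim : ∀ (F : ℕ → V → ℝ) (f : V → ℝ), (∀ k, P (F k)) →
      (∀ x, Filter.Tendsto (fun k => F k x) Filter.atTop (nhds (f x))) → P f)
    (hsm : ∀ F : V → ℝ, ContDiff ℝ (⊤ : ℕ∞) F → (∃ M, ∀ x, |F x| ≤ M) →
      (∀ x y, F x ≤ F y + L * ‖x - y‖) → P F)
    (f : V → ℝ) (hf : ∀ x y, f x ≤ f y + L * ‖x - y‖) : P f := by
  -- remove boundedness
  have hsm2 : ∀ F : V → ℝ, ContDiff ℝ (⊤ : ℕ∞) F →
      (∀ x y, F x ≤ F y + L * ‖x - y‖) → P F := by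
    intro F hF hFL
    have hat : ∀ x y : ℝ, |Real.arctan x - Real.arctan y| ≤ |x - y| := by
      have : LipschitzWith 1 Real.arctan := by
        refine lipschitzWith_of_nnnorm_deriv_le Real.differentiable_arctan fun x => ?_
        rw [Real.deriv_arctan, ← NNReal.coe_le_coe, coe_nnnorm, Real.norm_of_nonneg (by positivity)]
        simp
        exact inv_le_one_of_one_le₀ (by nlinarith)
      intro x y
      simpa [Real.dist_eq] using this.dist_le_mul x y
    refine hlim (fun m x => ((m : ℝ) + 1) * Real.arctan (((m : ℝ) + 1)⁻¹ * F x)) F ?_ ?_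
    · intro m
      have hm : (0 : ℝ) < (m : ℝ) + 1 := by positivity
      refine hsm _ ?_ ⟨((m : ℝ) + 1) * (Real.pi / 2), fun x => ?_⟩ ?_
      · exact contDiff_const.mul ((contDiff_const.mul hF).arctan)
      · rw [abs_mul, abs_of_pos hm]
        gcongr
        exact abs_le.2 ⟨by linarith [Real.neg_pi_div_two_lt_arctan (((m : ℝ) + 1)⁻¹ * F x)],
          (Real.arctan_lt_pi_div_two _).le⟩
      · intro x y
        have h1 := hat (((m : ℝ) + 1)⁻¹ * F x) (((m : ℝ) + 1)⁻¹ * F y)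
        have h2 : |F x - F y| ≤ L * ‖x - y‖ := by
          have := hFL x y
          have h' := hFL y x
          rw [norm_sub_rev] at h'
          exact abs_le.2 ⟨by linarith, by linarith⟩
        rw [← mul_sub, abs_mul, abs_of_pos (inv_pos.2 hm)] at h1
        have h3 := (le_abs_self _).trans h1
        have h4 : ((m : ℝ) + 1) * (Real.arctan (((m : ℝ) + 1)⁻¹ * F x) -
          Real.arctan (((m : ℝ) + 1)⁻¹ * F y)) ≤ ((m : ℝ) + 1) * (((m : ℝ) + 1)⁻¹ * |F x - F y|) := by
          gcongr
        rw [mul_inv_cancel_left₀ hm.ne'] at h4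
        linarith
    · intro x
      have hd : HasDerivAt (fun h : ℝ => Real.arctan (h * F x)) (F x) 0 := by
        have := ((hasDerivAt_id (0 : ℝ)).mul_const (F x)).arctan
        simpa using this
      have ht := hd.tendsto_slope_zero
      have h2 : Filter.Tendsto (fun m : ℕ => ((m : ℝ) + 1)⁻¹) Filter.atTop
          (nhdsWithin 0 {0}ᶜ) := by
        refine tendsto_nhdsWithin_iff.2 ⟨?_, Filter.Eventually.of_forall fun m => ?_⟩
        · simpa using tendsto_one_div_add_atTop_nhds_zero_nat (𝕜 := ℝ)
        · have : (0 : ℝ) < (m : ℝ) + 1 := by positivity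
          simp; positivity
      refine (ht.comp h2).congr fun m => ?_
      simp
  set y := TopologicalSpace.denseSeq V with hy
  have hyd : DenseRange y := TopologicalSpace.denseRange_denseSeq V
  choose ψ hψ1 hψ2 using fun k => exists_dual_vector'' ℝ (y k)
  have hψle : ∀ k v, ψ k v ≤ ‖v‖ := fun k v =>
    (le_abs_self _).trans (((ψ k).le_opNorm v).trans
      (mul_le_of_le_one_left (norm_nonneg _) (hψ1 k)))
  have hlub : ∀ v, IsLUB (Set.range fun k => L * ψ k v) (L * ‖v‖) := by
    intro v
    constructor
    · rintro _ ⟨k, rfl⟩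
      exact mul_le_mul_of_nonneg_left (hψle k v) hL
    · intro b hb
      refine le_of_forall_pos_le_add fun ε hε => ?_
      obtain ⟨k, hk⟩ := hyd.exists_dist_lt v (ε := ε / (2 * (L + 1))) (by positivity)
      have h1 : L * ψ k v ≤ b := hb ⟨k, rfl⟩
      have h2 : ψ k (y k) = ‖y k‖ := hψ2 k
      have h3 := hψle k (y k - v)
      rw [map_sub, h2] at h3
      have h4 : ‖v‖ ≤ ‖y k‖ + ‖v - y k‖ := norm_le_norm_add_norm_sub' v (y k)
      rw [norm_sub_rev] at h3
      rw [dist_eq_norm, lt_div_iff₀ (by positivity)] at hk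
      have h5 : ‖v‖ ≤ ψ k v + 2 * ‖v - y k‖ := by linarith
      have := mul_le_mul_of_nonneg_left h5 hL
      nlinarith [norm_nonneg (v - y k)]
  refine hlim (fun N x => -lse N (fun j => -(f (y j) + L * ‖x - y j‖))) f ?_ ?_
  · intro N
    refine hlim (fun K x => -lse N (fun j => -(f (y j) + lse K (fun k => L * ψ k (x - y j))))) _
      ?_ ?_
    · intro K
      refine hsm2 _ ?_ ?_
      · refine (lse_contDiff N _ fun j => ?_).neg
        refine (contDiff_const.add (lse_contDiff K _ fun k => ?_)).neg
        exact contDiff_const.mul ((ψ k).contDiff.comp (contDiff_id.sub contDiff_const))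
      · intro x z
        have : lse N (fun j => -(f (y j) + lse K (fun k => L * ψ k (z - y j)))) ≤
          lse N (fun j => -(f (y j) + lse K (fun k => L * ψ k (x - y j)))) + L * ‖x - z‖ := by
          refine lse_mono_add _ _ _ _ fun j => ?_
          have := lse_mono_add K (fun k => L * ψ k (x - y j)) (fun k => L * ψ k (z - y j))
            (L * ‖x - z‖) fun k => by
              have := mul_le_mul_of_nonneg_left (hψle k (x - z)) hL
              simp only [map_sub] at this ⊢
              nlinarith
          linarith
        linarith
    · intro x
      refine (lse_tendsto_args N _ _ fun j => ?_).neg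
      exact ((lse_tendsto _ _ (hlub (x - y j))).const_add _).neg
  · intro x
    have : IsLUB (Set.range fun j => -(f (y j) + L * ‖x - y j‖)) (- f x) := by
      constructor
      · rintro _ ⟨j, rfl⟩
        have := hf x (y j)
        simp only; linarith
      · intro b hb
        refine le_of_forall_pos_le_add fun ε hε => ?_
        obtain ⟨k, hk⟩ := hyd.exists_dist_lt x (ε := ε / (2 * (L + 1))) (by positivity)
        have h1 : -(f (y k) + L * ‖x - y k‖) ≤ b := hb ⟨k, rfl⟩
        have h2 := hf (y k) x
        rw [norm_sub_rev] at h2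
        rw [dist_eq_norm, lt_div_iff₀ (by positivity)] at hk
        nlinarith [norm_nonneg (x - y k)]
    simpa using (lse_tendsto _ _ this).neg

lemma subG_integral_zero {Ω : Type*} [MeasurableSpace Ω] (π : Measure Ω) [IsProbabilityMeasure π]
    (X : Ω → ℝ) (c : NNReal) (h : ProbabilityTheory.HasSubgaussianMGF X c π) :
    ∫ x, X x ∂π = 0 := by
  have hX := h.integrable
  have key : ∀ l : ℝ, 1 + l * ∫ x, X x ∂π ≤ Real.exp (c * l ^ 2 / 2) := by
    intro l
    refine le_trans ?_ (h.mgf_le l)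
    have : ∫ x, (1 + l * X x) ∂π = 1 + l * ∫ x, X x ∂π := by
      rw [integral_add (integrable_const _) (hX.const_mul _), integral_const_mul]; simp
    rw [← this]
    refine integral_mono ((integrable_const _).add (hX.const_mul _)) (h.integrable_exp_mul l) ?_
    intro x
    have := Real.add_one_le_exp (l * X x)
    simp only; linarith
  set a := ∫ x, X x ∂π
  have hmin : IsLocalMin (fun l : ℝ => Real.exp (c * l ^ 2 / 2) - (1 + l * a)) 0 := by
    refine Filter.Eventually.of_forall fun l => ?_
    have := key l
    simp; linarith
  have hd : HasDerivAt (fun l : ℝ => Real.exp (c * l ^ 2 / 2) - (1 + l * a)) (-a) 0 := by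
    have h1 : HasDerivAt (fun l : ℝ => (c : ℝ) * l ^ 2 / 2) 0 0 := by
      have := (((hasDerivAt_id (0 : ℝ)).pow 2).const_mul (c : ℝ)).div_const 2
      simpa using this
    have h2 := h1.exp.sub (((hasDerivAt_id (0 : ℝ)).mul_const a).const_add 1)
    refine h2.congr_deriv ?_
    simp
  have := hmin.hasDerivAt_eq_zero hd
  linarith

lemma subG_limit {Ω : Type*} [MeasurableSpace Ω] (π : Measure Ω) [IsProbabilityMeasure π]
    (c : NNReal) (F : ℕ → Ω → ℝ) (f : Ω → ℝ)
    (hF : ∀ k, ∃ m : ℝ, ProbabilityTheory.HasSubgaussianMGF (fun x => F k x - m) c π)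
    (hlim : ∀ x, Filter.Tendsto (fun k => F k x) Filter.atTop (nhds (f x))) :
    ∃ m : ℝ, ProbabilityTheory.HasSubgaussianMGF (fun x => f x - m) c π := by
  choose m hm using hF
  have hae : ∀ k, AEMeasurable (F k) π := by
    intro k
    have := (hm k).aemeasurable.add_const (m k)
    simpa using this
  have hlin : ∀ k (l : ℝ), ∫⁻ x, ENNReal.ofReal (Real.exp (l * (F k x - m k))) ∂π ≤
      ENNReal.ofReal (Real.exp (c * l ^ 2 / 2)) := by
    intro k l
    rw [← ofReal_integral_eq_lintegral_ofReal ((hm k).integrable_exp_mul l)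
      (Filter.Eventually.of_forall fun _ => (Real.exp_pos _).le)]
    exact ENNReal.ofReal_le_ofReal ((hm k).mgf_le l)
  have hfreq : ∃ R : ℝ, ∃ᶠ k in Filter.atTop, m k ∈ Metric.closedBall (0 : ℝ) R := by
    by_contra hcon
    push Not at hcon
    have htop : Filter.Tendsto (fun k => |m k|) Filter.atTop Filter.atTop := by
      refine Filter.tendsto_atTop.2 fun R => ?_
      filter_upwards [hcon R] with k hk
      simp at hk
      exact hk.le
    have hpt : ∀ x, Filter.Tendsto (fun k => ENNReal.ofReal (Real.exp (1 * (F k x - m k))) +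
        ENNReal.ofReal (Real.exp (-1 * (F k x - m k)))) Filter.atTop (nhds ⊤) := by
      intro x
      have h1 : Filter.Tendsto (fun k => |m k| + (- |F k x|)) Filter.atTop Filter.atTop :=
        Filter.Tendsto.atTop_add htop ((hlim x).abs.neg)
      have h2 : Filter.Tendsto (fun k => ENNReal.ofReal (Real.exp (|m k| + (- |F k x|))))
        Filter.atTop (nhds ⊤) :=
        ENNReal.tendsto_ofReal_atTop.comp (Real.tendsto_exp_atTop.comp h1)
      refine tendsto_nhds_top_mono' h2 fun k => ?_
      have h3 : |m k| - |F k x| ≤ |F k x - m k| := by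
        rw [abs_sub_comm]; exact abs_sub_abs_le_abs_sub _ _
      simp only
      rcases abs_cases (F k x - m k) with ⟨h, _⟩ | ⟨h, _⟩
      · refine le_trans (ENNReal.ofReal_le_ofReal (Real.exp_le_exp.2 ?_)) le_self_add
        linarith
      · refine le_trans (ENNReal.ofReal_le_ofReal (Real.exp_le_exp.2 ?_)) le_add_self
        linarith
    have hmeas : ∀ k (l : ℝ), AEMeasurable (fun x => ENNReal.ofReal (Real.exp (l * (F k x - m k)))) π :=
      fun k l => (((hae k).sub_const _).const_mul l).exp.ennreal_ofReal
    have hfat := lintegral_liminf_le' (μ := π) (u := Filter.atTop) (fun k => (hmeas k 1).add (hmeas k (-1)))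
    have e1 : ∀ x, Filter.liminf (fun k => ((fun x => ENNReal.ofReal (Real.exp (1 * (F k x - m k)))) +
        (fun x => ENNReal.ofReal (Real.exp (-1 * (F k x - m k))))) x) Filter.atTop = ⊤ :=
      fun x => (hpt x).liminf_eq
    simp_rw [e1] at hfat
    simp only [lintegral_const, measure_univ, mul_one, top_le_iff] at hfat
    have hle : Filter.liminf (fun k => ∫⁻ a, ((fun x => ENNReal.ofReal (Real.exp (1 * (F k x - m k)))) +
        (fun x => ENNReal.ofReal (Real.exp (-1 * (F k x - m k))))) a ∂π) Filter.atTop ≤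
        ENNReal.ofReal (Real.exp (c * 1 ^ 2 / 2)) + ENNReal.ofReal (Real.exp (c * (-1) ^ 2 / 2)) := by
      refine Filter.liminf_le_of_frequently_le' (Filter.Eventually.frequently
        (Filter.Eventually.of_forall fun k => ?_))
      simp only [Pi.add_apply]
      rw [lintegral_add_left' (hmeas k 1)]
      exact add_le_add (hlin k 1) (hlin k (-1))
    rw [hfat] at hle
    exact absurd hle (by simp)
  obtain ⟨R, hR⟩ := hfreq
  obtain ⟨m0, _, φ, hφ, hφlim⟩ := tendsto_subseq_of_frequently_bounded
    Metric.isBounded_closedBall hR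
  have hfm : AEMeasurable f π :=
    aemeasurable_of_tendsto_metrizable_ae' hae (Filter.Eventually.of_forall hlim)
  have hfinal : ∀ l : ℝ, ∫⁻ x, ENNReal.ofReal (Real.exp (l * (f x - m0))) ∂π ≤
      ENNReal.ofReal (Real.exp (c * l ^ 2 / 2)) := by
    intro l
    have hmeas : ∀ k, AEMeasurable (fun x => ENNReal.ofReal (Real.exp (l * (F (φ k) x - m (φ k))))) π :=
      fun k => (((hae (φ k)).sub_const _).const_mul l).exp.ennreal_ofReal
    have hfat := lintegral_liminf_le' (μ := π) (u := Filter.atTop) hmeas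
    have e1 : ∀ x, Filter.liminf (fun k => ENNReal.ofReal (Real.exp (l * (F (φ k) x - m (φ k)))))
        Filter.atTop = ENNReal.ofReal (Real.exp (l * (f x - m0))) := by
      intro x
      refine Filter.Tendsto.liminf_eq ?_
      refine ENNReal.tendsto_ofReal ((Real.continuous_exp.tendsto _).comp ?_)
      exact (((hlim x).comp hφ.tendsto_atTop).sub hφlim).const_mul l
    simp_rw [e1] at hfat
    refine hfat.trans ?_
    exact Filter.liminf_le_of_frequently_le' (Filter.Eventually.frequently
        (Filter.Eventually.of_forall fun k => hlin _ _))
  have h_integ : ∀ l : ℝ, Integrable (fun x => Real.exp (l * (f x - m0))) π := by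
    intro l
    refine ⟨((hfm.sub_const _).const_mul l).exp.aestronglyMeasurable, ?_⟩
    rw [hasFiniteIntegral_iff_ofReal (Filter.Eventually.of_forall fun _ => (Real.exp_pos _).le)]
    exact (hfinal l).trans_lt ENNReal.ofReal_lt_top
  refine ⟨m0, h_integ, fun l => ?_⟩
  have := hfinal l
  rw [← ofReal_integral_eq_lintegral_ofReal (h_integ l)
      (Filter.Eventually.of_forall fun _ => (Real.exp_pos _).le)] at this
  exact (ENNReal.ofReal_le_ofReal_iff (Real.exp_pos _).le).1 this
noncomputable def entE {X : Type*} [MeasurableSpace X] (μ : Measure X) (G : X → ℝ) : ℝ :=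
  ∫ x, Real.exp (G x) * G x ∂μ - (∫ x, Real.exp (G x) ∂μ) * Real.log (∫ x, Real.exp (G x) ∂μ)

lemma exp_integral_bounds {X : Type*} [MeasurableSpace X] (μ : Measure X) [IsProbabilityMeasure μ]
    (G : X → ℝ) (hG : Measurable G) (M : ℝ) (hM : ∀ x, |G x| ≤ M) :
    Real.exp (-M) ≤ ∫ x, Real.exp (G x) ∂μ ∧ ∫ x, Real.exp (G x) ∂μ ≤ Real.exp M := by
  have h_integ : Integrable (fun x => Real.exp (G x)) μ := by
    refine Integrable.of_bound hG.exp.aestronglyMeasurable (Real.exp M)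
      (Filter.Eventually.of_forall fun x => ?_)
    rw [Real.norm_of_nonneg (Real.exp_pos _).le]
    exact Real.exp_le_exp.2 (abs_le.1 (hM x)).2
  constructor
  · have := integral_mono (μ := μ) (integrable_const (Real.exp (-M))) h_integ
      (fun x => Real.exp_le_exp.2 (abs_le.1 (hM x)).1)
    simpa using this
  · have := integral_mono (μ := μ) h_integ (integrable_const (Real.exp M))
      (fun x => Real.exp_le_exp.2 (abs_le.1 (hM x)).2)
    simpa using this

lemma integrable_of_bdd {Z : Type*} [MeasurableSpace Z] (ρ : Measure Z) [IsProbabilityMeasure ρ]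
    (g : Z → ℝ) (hg : Measurable g) (hK : ∃ K, ∀ z, |g z| ≤ K) : Integrable g ρ := by
  obtain ⟨K, hK⟩ := hK
  exact Integrable.of_bound hg.aestronglyMeasurable K (Filter.Eventually.of_forall hK)

lemma ent_tensor_two {X Y : Type*} [MeasurableSpace X] [MeasurableSpace Y]
    (ν : Measure X) [IsProbabilityMeasure ν] (π : Measure Y) [IsProbabilityMeasure π]
    (G : X × Y → ℝ) (hG : Measurable G) (M : ℝ) (hM : ∀ q, |G q| ≤ M)
    (A B : X × Y → ℝ) (hA : Integrable A (ν.prod π)) (hB : Integrable B (ν.prod π))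
    (h1 : ∀ y, entE ν (fun x => G (x, y)) ≤ ∫ x, A (x, y) ∂ν)
    (h2 : ∀ x, entE π (fun y => G (x, y)) ≤ ∫ y, B (x, y) ∂π) :
    entE (ν.prod π) G ≤ ∫ q, (A q + B q) ∂(ν.prod π) := by
  set h : X → ℝ := fun x => ∫ y, Real.exp (G (x, y)) ∂π with hh
  set k : Y → ℝ := fun y => ∫ x, Real.exp (G (x, y)) ∂ν with hk
  have hhm : Measurable h := (hG.exp.stronglyMeasurable.integral_prod_right').measurable
  have hkm : Measurable k := (hG.exp.stronglyMeasurable.integral_prod_left').measurable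
  have hhb : ∀ x, Real.exp (-M) ≤ h x ∧ h x ≤ Real.exp M := fun x =>
    exp_integral_bounds π _ (hG.comp measurable_prodMk_left) M (fun y => hM _)
  have hkb : ∀ y, Real.exp (-M) ≤ k y ∧ k y ≤ Real.exp M := fun y =>
    exp_integral_bounds ν _ (hG.comp measurable_prodMk_right) M (fun y => hM _)
  have hhp : ∀ x, 0 < h x := fun x => (Real.exp_pos _).trans_le (hhb x).1
  have hkp : ∀ x, 0 < k x := fun x => (Real.exp_pos _).trans_le (hkb x).1
  have hlogb : ∀ a : ℝ, Real.exp (-M) ≤ a ∧ a ≤ Real.exp M → |Real.log a| ≤ M := by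
    intro a ha
    have hap : 0 < a := (Real.exp_pos _).trans_le ha.1
    exact abs_le.2 ⟨(Real.le_log_iff_exp_le hap).2 ha.1, (Real.log_le_iff_le_exp hap).2 ha.2⟩
  set Z := ∫ q, Real.exp (G q) ∂(ν.prod π) with hZ
  have hZb := exp_integral_bounds (ν.prod π) G hG M hM
  have hZp : 0 < Z := (Real.exp_pos _).trans_le hZb.1
  have hexpb : ∀ q, |Real.exp (G q)| ≤ Real.exp M := fun q => by
    rw [abs_of_pos (Real.exp_pos _)]; exact Real.exp_le_exp.2 (abs_le.1 (hM q)).2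
  have hm2 : ∀ {a b c d : ℝ}, |a| ≤ c → |b| ≤ d → |a * b| ≤ c * d := fun {a b c d} p q => by
    rw [abs_mul]; exact mul_le_mul p q (abs_nonneg _) ((abs_nonneg _).trans p)
  have habs : ∀ a : ℝ, Real.exp (-M) ≤ a ∧ a ≤ Real.exp M → |a| ≤ Real.exp M := fun a ha => by
    rw [abs_of_pos ((Real.exp_pos _).trans_le ha.1)]; exact ha.2
  -- integrability
  have i0 : Integrable (fun q => Real.exp (G q)) (ν.prod π) := integrable_of_bdd _ _ hG.exp ⟨_, hexpb⟩
  have i1 : Integrable (fun q => Real.exp (G q) * G q) (ν.prod π) :=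
    integrable_of_bdd _ _ (hG.exp.mul hG) ⟨_, fun q => hm2 (hexpb q) (hM q)⟩
  have i2 : Integrable (fun q : X × Y => Real.exp (G q) * Real.log (h q.1)) (ν.prod π) :=
    integrable_of_bdd _ _ (hG.exp.mul (hhm.comp measurable_fst).log)
      ⟨_, fun q => hm2 (hexpb q) (hlogb _ (hhb _))⟩
  have i3 : Integrable (fun q : X × Y => Real.exp (G q) * Real.log (k q.2)) (ν.prod π) :=
    integrable_of_bdd _ _ (hG.exp.mul (hkm.comp measurable_snd).log)
      ⟨_, fun q => hm2 (hexpb q) (hlogb _ (hkb _))⟩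
  have i4 : Integrable (fun q : X × Y => h q.1 * k q.2) (ν.prod π) :=
    integrable_of_bdd _ _ ((hhm.comp measurable_fst).mul (hkm.comp measurable_snd))
      ⟨_, fun q => hm2 (habs _ (hhb _)) (habs _ (hkb _))⟩
  have i5 : Integrable (fun x => h x * Real.log (h x)) ν :=
    integrable_of_bdd _ _ (hhm.mul hhm.log) ⟨_, fun q => hm2 (habs _ (hhb _)) (hlogb _ (hhb _))⟩
  have i6 : Integrable (fun x => k x * Real.log (k x)) π :=
    integrable_of_bdd _ _ (hkm.mul hkm.log) ⟨_, fun q => hm2 (habs _ (hkb _)) (hlogb _ (hkb _))⟩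
  -- Fubini computations
  have e2 : ∫ q : X × Y, Real.exp (G q) * Real.log (h q.1) ∂(ν.prod π) =
      ∫ x, h x * Real.log (h x) ∂ν := by
    rw [integral_prod _ i2]
    simp only [integral_mul_const, hh]
  have e3 : ∫ q : X × Y, Real.exp (G q) * Real.log (k q.2) ∂(ν.prod π) =
      ∫ x, k x * Real.log (k x) ∂π := by
    rw [integral_prod_symm _ i3]
    simp only [integral_mul_const, hk]
  have eh : ∫ x, h x ∂ν = Z := by rw [hZ, integral_prod _ i0]
  have ek : ∫ y, k y ∂π = Z := by rw [hZ, integral_prod_symm _ i0]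
  have e4 : ∫ q : X × Y, h q.1 * k q.2 ∂(ν.prod π) = Z * Z := by
    rw [integral_prod_mul, eh, ek]
  have key : 0 ≤ ∫ q : X × Y, (Real.exp (G q) * G q - Real.exp (G q) * Real.log (h q.1)
      - Real.exp (G q) * Real.log (k q.2) + Real.exp (G q) * (Real.log Z - 1)
      + h q.1 * k q.2 * Z⁻¹) ∂(ν.prod π) := by
    refine integral_nonneg fun q => ?_
    have hb : 0 < h q.1 * k q.2 * Z⁻¹ := by
      have := hhp q.1; have := hkp q.2; positivity
    have hlog : Real.log (h q.1 * k q.2 * Z⁻¹) = Real.log (h q.1) + Real.log (k q.2) - Real.log Z := by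
      rw [Real.log_mul (mul_pos (hhp _) (hkp _)).ne' (inv_pos.2 hZp).ne',
        Real.log_mul (hhp _).ne' (hkp _).ne', Real.log_inv]; ring
    have := Real.add_one_le_exp (Real.log (h q.1 * k q.2 * Z⁻¹) - G q)
    rw [Real.exp_sub, Real.exp_log hb, le_div_iff₀ (Real.exp_pos _), hlog] at this
    simp only [Pi.zero_apply]
    nlinarith
  have j1 : Integrable (fun q : X × Y => Real.exp (G q) * G q
      - Real.exp (G q) * Real.log (h q.1)) (ν.prod π) := i1.sub i2
  have j2 : Integrable (fun q : X × Y => Real.exp (G q) * G q - Real.exp (G q) * Real.log (h q.1)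
      - Real.exp (G q) * Real.log (k q.2)) (ν.prod π) := j1.sub i3
  have j3 : Integrable (fun q : X × Y => Real.exp (G q) * G q - Real.exp (G q) * Real.log (h q.1)
      - Real.exp (G q) * Real.log (k q.2) + Real.exp (G q) * (Real.log Z - 1)) (ν.prod π) :=
    j2.add (i0.mul_const _)
  rw [integral_add j3 (i4.mul_const _), integral_add j2 (i0.mul_const _), integral_sub j1 i3,
    integral_sub i1 i2, integral_mul_const, integral_mul_const, e2, e3, e4, ← hZ,
    mul_assoc, mul_inv_cancel₀ hZp.ne'] at key
  -- marginal entropies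
  have m1 : ∫ q, Real.exp (G q) * G q ∂(ν.prod π) - ∫ y, k y * Real.log (k y) ∂π
      ≤ ∫ q, A q ∂(ν.prod π) := by
    rw [integral_prod_symm _ i1, integral_prod_symm _ hA, ← integral_sub i1.integral_prod_right i6]
    exact integral_mono (i1.integral_prod_right.sub i6) hA.integral_prod_right fun y => h1 y
  have m2 : ∫ q, Real.exp (G q) * G q ∂(ν.prod π) - ∫ y, h y * Real.log (h y) ∂ν
      ≤ ∫ q, B q ∂(ν.prod π) := by
    rw [integral_prod _ i1, integral_prod _ hB, ← integral_sub i1.integral_prod_left i5]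
    exact integral_mono (i1.integral_prod_left.sub i5) hB.integral_prod_left fun y => h2 y
  rw [integral_add hA hB]
  unfold entE
  rw [← hZ]
  nlinarith

lemma ent_tensor {E : Type*} [MeasurableSpace E] (μ : Measure E) [IsProbabilityMeasure μ] :
    ∀ (n : ℕ) (G : (Fin n → E) → ℝ) (_ : Measurable G) (M : ℝ) (_ : ∀ x, |G x| ≤ M)
    (D : Fin n → (Fin n → E) → ℝ) (_ : ∀ i, Measurable (D i)) (K : ℝ) (_ : ∀ i x, |D i x| ≤ K)
    (_ : ∀ i x, entE μ (fun y => G (Function.update x i y)) ≤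
      ∫ y, D i (Function.update x i y) ∂μ),
    entE (Measure.pi fun _ : Fin n => μ) G ≤ ∫ x, ∑ i, D i x ∂(Measure.pi fun _ : Fin n => μ) := by
  intro n
  induction n with
  | zero =>
    intro G hG M hM D hD K hK h
    have : G = fun _ => G default := by
      funext x; congr 1; exact Subsingleton.elim _ _
    rw [this]
    simp [entE]
  | succ n ih =>
    intro G hG M hM D hD K hK h
    have hmp := measurePreserving_piFinSuccAbove (fun _ : Fin (n + 1) => μ) 0
    have hmp' := hmp.symm
    set e := (MeasurableEquiv.piFinSuccAbove (fun _ : Fin (n + 1) => E) 0).symm with he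
    have hev : ∀ q : E × (Fin n → E), e q = Fin.cons q.1 q.2 := by
      intro q
      simp [he, MeasurableEquiv.piFinSuccAbove, Fin.insertNthEquiv]
    set π := Measure.pi (fun _ : Fin n => μ) with hπ
    have hmp'' : MeasurePreserving e (μ.prod π) (Measure.pi fun _ : Fin (n + 1) => μ) := hmp'
    have h_integ : ∀ g : (Fin (n + 1) → E) → ℝ, ∫ x, g x ∂(Measure.pi fun _ : Fin (n + 1) => μ)
        = ∫ q, g (e q) ∂(μ.prod π) := fun g =>
      (hmp''.integral_comp' (f := e) g).symm
    have e1 : entE (Measure.pi fun _ : Fin (n + 1) => μ) G = entE (μ.prod π) (fun q => G (e q)) := by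
      unfold entE
      rw [h_integ, h_integ]
    rw [e1, h_integ]
    have hbd : ∀ i, Integrable (fun q => D i (e q)) (μ.prod π) := fun i =>
      Integrable.of_bound ((hD i).comp e.measurable).aestronglyMeasurable K
        (Filter.Eventually.of_forall fun q => hK _ _)
    have := ent_tensor_two μ π (fun q => G (e q)) (hG.comp e.measurable) M (fun q => hM _)
      (fun q => D 0 (e q)) (fun q => ∑ i : Fin n, D i.succ (e q)) (hbd 0)
      (integrable_finsetSum _ fun i _ => hbd _) ?_ ?_
    · simpa only [Fin.sum_univ_succ] using this
    · intro y
      rcases isEmpty_or_nonempty E with hE | ⟨⟨z⟩⟩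
      · simp [entE, Measure.eq_zero_of_isEmpty]
      have := h 0 (Fin.cons z y)
      simpa only [hev, Fin.update_cons_zero] using this
    · intro x
      refine ih (fun y => G (e (x, y))) ((hG.comp e.measurable).comp measurable_prodMk_left) M
        (fun y => hM _) (fun i y => D i.succ (e (x, y)))
        (fun i => ((hD _).comp e.measurable).comp measurable_prodMk_left) K (fun i y => hK _ _) ?_
      intro i y
      have := h i.succ (Fin.cons x y)
      simpa only [hev, Fin.cons_update] using this

lemma herbst_pos {Ω : Type*} [MeasurableSpace Ω] (π : Measure Ω) [IsProbabilityMeasure π]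
    (X : Ω → ℝ) (hX : Measurable X) (M : ℝ) (hM : ∀ x, |X x| ≤ M) (c : ℝ)
    (h : ∀ l : ℝ, entE π (fun x => l * X x) ≤ c * l ^ 2 / 2 * ∫ x, Real.exp (l * X x) ∂π)
    (l : ℝ) (hl : 0 < l) :
    ProbabilityTheory.mgf X π l ≤ Real.exp (l * ∫ x, X x ∂π + c * l ^ 2 / 2) := by
  have h_integ : ∀ l : ℝ, Integrable (fun x => Real.exp (l * X x)) π := by
    intro l
    refine integrable_of_bdd _ _ (hX.const_mul l).exp ⟨Real.exp (|l| * M), fun z => ?_⟩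
    rw [abs_of_pos (Real.exp_pos _)]
    refine Real.exp_le_exp.2 ((le_abs_self _).trans ?_)
    rw [abs_mul]
    exact mul_le_mul_of_nonneg_left (hM z) (abs_nonneg _)
  have hset : ProbabilityTheory.integrableExpSet X π = Set.univ :=
    Set.eq_univ_of_forall fun l => h_integ l
  have hmem : ∀ l, l ∈ interior (ProbabilityTheory.integrableExpSet X π) := by
    intro l; rw [hset]; simp
  set Φ := ProbabilityTheory.mgf X π with hΦ
  have hpos : ∀ l, 0 < Φ l := fun l => ProbabilityTheory.mgf_pos (h_integ l)
  have hder : ∀ l, HasDerivAt Φ (∫ x, X x * Real.exp (l * X x) ∂π) l := fun l =>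
    ProbabilityTheory.hasDerivAt_mgf (hmem l)
  have hderK : ∀ l, HasDerivAt (fun l => Real.log (Φ l))
      ((∫ x, X x * Real.exp (l * X x) ∂π) / Φ l) l := fun l => (hder l).log (hpos l).ne'
  have hent : ∀ l, l * ((∫ x, X x * Real.exp (l * X x) ∂π) / Φ l) - Real.log (Φ l)
      ≤ c * l ^ 2 / 2 := by
    intro l
    have h1 := h l
    unfold entE at h1
    have e : ∫ x, Real.exp (l * X x) * (l * X x) ∂π = l * ∫ x, X x * Real.exp (l * X x) ∂π := by
      rw [← integral_const_mul]
      congr 1; funext x; ring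
    have e2 : ∫ x, Real.exp (l * X x) ∂π = Φ l := rfl
    rw [e, e2] at h1
    have hp := hpos l
    have : l * ((∫ x, X x * Real.exp (l * X x) ∂π) / Φ l) - Real.log (Φ l) =
      (l * (∫ x, X x * Real.exp (l * X x) ∂π) - Φ l * Real.log (Φ l)) / Φ l := by
      field_simp
    rw [this, div_le_iff₀ hp]
    exact h1
  have hΦ0 : Φ 0 = 1 := by simp [hΦ]
  set g : ℝ → ℝ := fun l => Real.log (Φ l) / l - c * l / 2 with hg
  have hgder : ∀ l, 0 < l → HasDerivAt g
      ((((∫ x, X x * Real.exp (l * X x) ∂π) / Φ l) * l - Real.log (Φ l) * 1) / l ^ 2 - c * 1 / 2) l := by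
    intro l hl
    exact ((hderK l).div (hasDerivAt_id l) hl.ne').sub (((hasDerivAt_id l).const_mul c).div_const 2)
  have hanti : AntitoneOn g (Set.Ioi 0) := by
    refine antitoneOn_of_deriv_nonpos (convex_Ioi 0) ?_ ?_ ?_
    · exact fun l hl => (hgder l hl).continuousAt.continuousWithinAt
    · intro l hl
      rw [interior_Ioi] at hl
      exact (hgder l hl).differentiableAt.differentiableWithinAt
    · intro l hl
      rw [interior_Ioi] at hl
      rw [(hgder l hl).deriv]
      have hl' : 0 < l := hl
      have := hent l
      rw [sub_nonpos, div_le_iff₀ (by positivity)]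
      nlinarith
  have hlim : Filter.Tendsto g (nhdsWithin 0 (Set.Ioi 0)) (nhds (∫ x, X x ∂π)) := by
    have h0 := hderK 0
    have h1 := h0.tendsto_slope_zero_right
    simp only [zero_add, hΦ0, Real.log_one, sub_zero, smul_eq_mul, zero_mul, Real.exp_zero,
      mul_one, div_one] at h1
    have h2 : Filter.Tendsto (fun l : ℝ => c * l / 2) (nhdsWithin 0 (Set.Ioi 0)) (nhds 0) := by
      have : Continuous (fun l : ℝ => c * l / 2) := by fun_prop
      have := this.tendsto 0
      simp only [mul_zero, zero_div] at this
      exact this.mono_left nhdsWithin_le_nhds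
    have h3 := h1.sub h2
    rw [sub_zero] at h3
    refine h3.congr fun l => ?_
    simp only [hg]; ring
  have hle : g l ≤ ∫ x, X x ∂π := by
    refine ge_of_tendsto hlim ?_
    have : Set.Ioo 0 l ∈ nhdsWithin (0 : ℝ) (Set.Ioi 0) := Ioo_mem_nhdsGT hl
    filter_upwards [this] with s hs
    exact hanti hs.1 hl hs.2.le
  simp only [hg] at hle
  rw [← Real.log_le_iff_le_exp (hpos l)]
  have h5 : Real.log (Φ l) / l ≤ ∫ x, X x ∂π + c * l / 2 := by linarith
  rw [div_le_iff₀ hl] at h5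
  linarith

lemma herbst {Ω : Type*} [MeasurableSpace Ω] (π : Measure Ω) [IsProbabilityMeasure π]
    (X : Ω → ℝ) (hX : Measurable X) (M : ℝ) (hM : ∀ x, |X x| ≤ M) (c : NNReal)
    (h : ∀ l : ℝ, entE π (fun x => l * X x) ≤ c * l ^ 2 / 2 * ∫ x, Real.exp (l * X x) ∂π) :
    ProbabilityTheory.HasSubgaussianMGF (fun x => X x - ∫ y, X y ∂π) c π := by
  refine ⟨fun l => ?_, fun l => ?_⟩
  · refine integrable_of_bdd _ _ ((hX.sub_const _).const_mul l).exp
      ⟨Real.exp (|l| * (M + |∫ y, X y ∂π|)), fun z => ?_⟩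
    rw [abs_of_pos (Real.exp_pos _)]
    refine Real.exp_le_exp.2 ((le_abs_self _).trans ?_)
    rw [abs_mul]
    refine mul_le_mul_of_nonneg_left ?_ (abs_nonneg _)
    exact (abs_sub _ _).trans (add_le_add (hM z) le_rfl)
  · have key : ProbabilityTheory.mgf X π l ≤ Real.exp (l * ∫ x, X x ∂π + c * l ^ 2 / 2) := by
      rcases lt_trichotomy l 0 with hl | hl | hl
      · have := herbst_pos π (fun x => - X x) hX.neg M (fun x => by simpa using hM x) c
          (fun s => by simpa using h (-s)) (-l) (by linarith)
        simpa [ProbabilityTheory.mgf, integral_neg] using this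
      · subst hl; simp
      · exact herbst_pos π X hX M hM c h l hl
    have e : ProbabilityTheory.mgf (fun x => X x - ∫ y, X y ∂π) π l =
        Real.exp (-(l * ∫ y, X y ∂π)) * ProbabilityTheory.mgf X π l := by
      unfold ProbabilityTheory.mgf
      rw [← integral_const_mul]
      congr 1; funext x
      rw [← Real.exp_add]; ring_nf
    rw [e]
    calc _ ≤ Real.exp (-(l * ∫ y, X y ∂π)) * Real.exp (l * ∫ x, X x ∂π + c * l ^ 2 / 2) := by gcongr
      _ = _ := by rw [← Real.exp_add]; congr 1; ring


lemma partial_bound {E : Type*} [NormedAddCommGroup E] [NormedSpace ℝ E] {n : ℕ}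
    (T : (Fin n → E) →L[ℝ] ℝ) (J : Fin n → E →L[ℝ] (Fin n → E)) (hJ : ∀ i v, J i v = Pi.single i v)
    (L : ℝ) (hL : 0 ≤ L)
    (h : ∀ v, T v ≤ L * Real.sqrt (∑ i, ‖v i‖ ^ 2)) :
    ∑ i, ‖T.comp (J i)‖ ^ 2 ≤ L ^ 2 := by
  set a : Fin n → ℝ := fun i => ‖T.comp (J i)‖ with ha
  have ha0 : ∀ i, 0 ≤ a i := fun i => norm_nonneg _
  set S := ∑ i, a i ^ 2 with hS
  have hS0 : 0 ≤ S := Finset.sum_nonneg fun i _ => sq_nonneg _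
  have hA0 : 0 ≤ ∑ i, a i := Finset.sum_nonneg fun i _ => ha0 i
  have key : S ≤ L * Real.sqrt S := by
    refine le_of_forall_pos_le_add fun ε hε => ?_
    set δ := ε / (∑ i, a i + 1) with hδ
    have hδp : 0 < δ := by positivity
    have hex : ∀ i, ∃ v : E, ‖v‖ ≤ 1 ∧ a i - δ ≤ T (Pi.single i v) := by
      intro i
      obtain ⟨v, hv1, hv2⟩ := ContinuousLinearMap.exists_lt_apply_of_lt_opNorm (T.comp (J i))
        (r := a i - δ) (by simp only [ha]; linarith)
      rw [ContinuousLinearMap.comp_apply, hJ, Real.norm_eq_abs] at hv2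
      rcases abs_cases (T (Pi.single i v)) with ⟨h, _⟩ | ⟨h, _⟩
      · exact ⟨v, hv1.le, by linarith⟩
      · refine ⟨-v, by simpa using hv1.le, ?_⟩
        rw [Pi.single_neg, map_neg]; linarith
    choose v hv1 hv2 using hex
    have h1 := h (fun i => a i • v i)
    have e1 : T (fun i => a i • v i) = ∑ i, a i * T (Pi.single i (v i)) := by
      have : (fun i => a i • v i) = ∑ i, a i • (Pi.single i (v i) : Fin n → E) := by
        funext j
        simp [Finset.sum_apply, Pi.single_apply]
      rw [this, map_sum]
      simp
    have h2 : S - δ * ∑ i, a i ≤ T (fun i => a i • v i) := by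
      rw [e1, hS, Finset.mul_sum, ← Finset.sum_sub_distrib]
      refine Finset.sum_le_sum fun i _ => ?_
      nlinarith [ha0 i, hv2 i]
    have h3 : Real.sqrt (∑ i, ‖a i • v i‖ ^ 2) ≤ Real.sqrt S := by
      refine Real.sqrt_le_sqrt (Finset.sum_le_sum fun i _ => ?_)
      rw [norm_smul, Real.norm_of_nonneg (ha0 i)]
      have : a i * ‖v i‖ ≤ a i := mul_le_of_le_one_right (ha0 i) (hv1 i)
      have h0 : 0 ≤ a i * ‖v i‖ := mul_nonneg (ha0 i) (norm_nonneg _)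
      exact pow_le_pow_left₀ h0 this 2
    have h4 : δ * ∑ i, a i ≤ ε := by
      rw [hδ, div_mul_eq_mul_div, div_le_iff₀ (by positivity)]
      nlinarith
    have := mul_le_mul_of_nonneg_left h3 hL
    linarith
  have hsq := Real.sq_sqrt hS0
  have hs0 := Real.sqrt_nonneg S
  rcases hs0.eq_or_lt with h0 | h0
  · rw [← h0] at hsq; nlinarith
  · have : Real.sqrt S ≤ L := by
      by_contra hcon
      push Not at hcon
      have := mul_lt_mul_of_pos_right hcon h0
      nlinarith
    nlinarith

lemma ent_smooth {E : Type*} [NormedAddCommGroup E] [NormedSpace ℝ E] [MeasurableSpace E]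
    [BorelSpace E] [SecondCountableTopology E]
    (μ : Measure E) [IsProbabilityMeasure μ]
    (C : ℝ) (hC : 0 < C) (hLS : LogSobolev μ C) {n : ℕ} (L : ℝ) (hL : 0 ≤ L)
    (F : (Fin n → E) → ℝ) (hF : ContDiff ℝ (⊤ : ℕ∞) F) (M : ℝ) (hM : ∀ x, |F x| ≤ M)
    (hLip : ∀ x y, F x ≤ F y + L * Real.sqrt (∑ i, ‖x i - y i‖ ^ 2)) (l : ℝ) :
    entE (Measure.pi fun _ : Fin n => μ) (fun x => l * F x) ≤
      (C * L ^ 2) * l ^ 2 / 2 * ∫ x, Real.exp (l * F x) ∂(Measure.pi fun _ : Fin n => μ) := by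
  classical
  set J : Fin n → E →L[ℝ] (Fin n → E) :=
    fun i => ContinuousLinearMap.pi (Pi.single i (ContinuousLinearMap.id ℝ E)) with hJd
  have hJ : ∀ i v, J i v = Pi.single i v := by
    intro i v
    funext j
    simp only [hJd, ContinuousLinearMap.pi_apply]
    by_cases hij : j = i
    · subst hij; simp
    · simp [hij]
  have hFd : Differentiable ℝ F := hF.differentiable (by simp)
  have hder : ∀ x v, fderiv ℝ F x v ≤ L * Real.sqrt (∑ i, ‖v i‖ ^ 2) := by
    intro x v
    have hline : HasDerivAt (fun s : ℝ => F (x + s • v)) (fderiv ℝ F x v) 0 := by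
      have h1 : HasDerivAt (fun s : ℝ => x + s • v) v 0 := by
        simpa using ((hasDerivAt_id (0 : ℝ)).smul_const v).const_add x
      have h2 : HasFDerivAt F (fderiv ℝ F x) (x + (0 : ℝ) • v) := by
        simpa using (hFd x).hasFDerivAt
      exact h2.comp_hasDerivAt (0 : ℝ) h1
    have ht := hline.tendsto_slope_zero_right
    refine le_of_tendsto ht ?_
    filter_upwards [self_mem_nhdsWithin] with s hs
    have hs' : 0 < s := hs
    have := hLip (x + s • v) x
    have e : Real.sqrt (∑ i, ‖(x + s • v) i - x i‖ ^ 2) = s * Real.sqrt (∑ i, ‖v i‖ ^ 2) := by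
      have : ∑ i, ‖(x + s • v) i - x i‖ ^ 2 = s ^ 2 * ∑ i, ‖v i‖ ^ 2 := by
        rw [Finset.mul_sum]
        refine Finset.sum_congr rfl fun i _ => ?_
        simp [norm_smul, abs_of_pos hs', mul_pow]
      rw [this, Real.sqrt_mul (by positivity), Real.sqrt_sq hs'.le]
    rw [e] at this
    simp only [zero_add, zero_smul, add_zero, smul_eq_mul]
    rw [inv_mul_le_iff₀ hs']
    linarith
  set P : Fin n → (Fin n → E) → ℝ := fun i x => ‖(fderiv ℝ F x).comp (J i)‖ with hP
  have hPsum : ∀ x, ∑ i, P i x ^ 2 ≤ L ^ 2 := fun x => partial_bound _ J hJ L hL (hder x)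
  have hP0 : ∀ i x, 0 ≤ P i x := fun i x => norm_nonneg _
  have hPi : ∀ i x, P i x ^ 2 ≤ L ^ 2 := fun i x =>
    (Finset.single_le_sum (f := fun i => P i x ^ 2) (fun _ _ => sq_nonneg _)
      (Finset.mem_univ i)).trans (hPsum x)
  have hPc : ∀ i, Continuous (P i) := fun i =>
    ((hF.continuous_fderiv (by simp)).clm_comp continuous_const).norm
  have hFc : Continuous F := hF.continuous
  have hlM : ∀ x, |l * F x| ≤ |l| * M := fun x => by
    rw [abs_mul]; exact mul_le_mul_of_nonneg_left (hM x) (abs_nonneg _)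
  have hexpM : ∀ x, Real.exp (l * F x) ≤ Real.exp (|l| * M) := fun x =>
    Real.exp_le_exp.2 ((le_abs_self _).trans (hlM x))
  have hmain := ent_tensor μ n (fun x => l * F x) (by fun_prop) (|l| * M) hlM
    (fun i x => C * l ^ 2 / 2 * (P i x ^ 2 * Real.exp (l * F x)))
    (fun i => by
      have := hPc i
      exact Continuous.measurable (by fun_prop))
    (C * l ^ 2 / 2 * (L ^ 2 * Real.exp (|l| * M)))
    (fun i x => by
      rw [abs_of_nonneg (by positivity)]
      exact mul_le_mul_of_nonneg_left (mul_le_mul (hPi i x) (hexpM x) (Real.exp_pos _).le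
        (sq_nonneg _)) (by positivity)) ?_
  · refine hmain.trans ?_
    rw [← integral_const_mul]
    have hie : Integrable (fun x => Real.exp (l * F x)) (Measure.pi fun _ : Fin n => μ) :=
      integrable_of_bdd _ _ (Continuous.measurable (by fun_prop))
        ⟨Real.exp (|l| * M), fun z => by rw [abs_of_pos (Real.exp_pos _)]; exact hexpM z⟩
    refine integral_mono_of_nonneg (Filter.Eventually.of_forall fun x => ?_) (hie.const_mul _)
      (Filter.Eventually.of_forall fun x => ?_)
    · exact Finset.sum_nonneg fun i _ => by positivity
    · simp only
      rw [← Finset.mul_sum, ← Finset.sum_mul]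
      have h1 : (∑ i, P i x ^ 2) * Real.exp (l * F x) ≤ L ^ 2 * Real.exp (l * F x) :=
        mul_le_mul_of_nonneg_right (hPsum x) (Real.exp_pos _).le
      have := mul_le_mul_of_nonneg_left h1 (show 0 ≤ C * l ^ 2 / 2 by positivity)
      linarith
  · intro i x
    set f : E → ℝ := fun y => Real.exp (l / 2 * F (Function.update x i y)) with hf
    have hup : ContDiff ℝ (⊤ : ℕ∞) (Function.update x i) := contDiff_update _ x i
    have hupc : Continuous (Function.update x i) := hup.continuous
    have hfs : ContDiff ℝ (⊤ : ℕ∞) f := (contDiff_const.mul (hF.comp hup)).exp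
    have hf2 : ∀ y, f y ^ 2 = Real.exp (l * F (Function.update x i y)) := by
      intro y
      rw [hf, sq, ← Real.exp_add]; ring_nf
    have hfd : ∀ y, ‖fderiv ℝ f y‖ ^ 2 = l ^ 2 / 4 * (P i (Function.update x i y) ^ 2 *
        Real.exp (l * F (Function.update x i y))) := by
      intro y
      have h1 : HasFDerivAt (fun y => F (Function.update x i y))
          ((fderiv ℝ F (Function.update x i y)).comp (J i)) y :=
        (hFd _).hasFDerivAt.comp y (hasFDerivAt_update x y)
      have h2 := (h1.const_mul (l / 2)).exp
      rw [h2.fderiv, norm_smul, norm_smul, mul_pow, mul_pow, Real.norm_of_nonneg (Real.exp_pos _).le,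
        Real.norm_eq_abs, sq_abs, ← hf2 y]
      simp only [hP, hf]
      ring
    have := hLS f hfs ?_ ?_ ?_
    · simp only [hfd, hf2, Real.log_exp] at this
      unfold entE
      refine this.trans (le_of_eq ?_)
      rw [integral_const_mul, integral_const_mul]
      ring
    · simp only [hf2, Real.log_exp]
      refine integrable_of_bdd _ _ (Continuous.measurable (by fun_prop))
        ⟨Real.exp (|l| * M) * (|l| * M), fun z => ?_⟩
      rw [abs_mul, abs_of_pos (Real.exp_pos _)]
      exact mul_le_mul (hexpM _) (hlM _) (abs_nonneg _) (Real.exp_pos _).le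
    · simp only [hf2]
      refine integrable_of_bdd _ _ (Continuous.measurable (by fun_prop))
        ⟨Real.exp (|l| * M), fun z => ?_⟩
      rw [abs_of_pos (Real.exp_pos _)]
      exact hexpM _
    · simp only [hfd]
      have hPci := hPc i
      refine integrable_of_bdd _ _ (Continuous.measurable (by fun_prop))
        ⟨l ^ 2 / 4 * (L ^ 2 * Real.exp (|l| * M)), fun z => ?_⟩
      rw [abs_of_nonneg (by positivity)]
      exact mul_le_mul_of_nonneg_left (mul_le_mul (hPi i _) (hexpM _) (Real.exp_pos _).le
        (sq_nonneg _)) (by positivity)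

lemma lip_concentration {E : Type*} [NormedAddCommGroup E] [NormedSpace ℝ E] [MeasurableSpace E]
    [BorelSpace E] [SecondCountableTopology E]
    (μ : Measure E) [IsProbabilityMeasure μ]
    (C : ℝ) (hC : 0 < C) (hLS : LogSobolev μ C) {n : ℕ} (L : ℝ) (hL : 0 ≤ L)
    (f : (Fin n → E) → ℝ)
    (hf : ∀ x y, f x ≤ f y + L * Real.sqrt (∑ i, ‖x i - y i‖ ^ 2)) (t : ℝ) (ht : 0 < t) :
    (Measure.pi fun _ : Fin n => μ)
        {x | t ≤ f x - ∫ y, f y ∂(Measure.pi fun _ : Fin n => μ)}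
      ≤ ENNReal.ofReal (Real.exp (-t ^ 2 / (2 * (C * L ^ 2)))) := by
  set π := Measure.pi fun _ : Fin n => μ with hπ
  set c : NNReal := ⟨C * L ^ 2, by positivity⟩ with hc
  have hcl := approx_class (V := PiLp 2 (fun _ : Fin n => E)) L hL
    (fun g => ∃ m : ℝ, ProbabilityTheory.HasSubgaussianMGF
      (fun x : Fin n → E => g (WithLp.toLp 2 x) - m) c π) ?_ ?_ (fun v => f (WithLp.ofLp v)) ?_
  · obtain ⟨m, hm⟩ := hcl
    have h0 := subG_integral_zero π _ c hm
    have h_integ : Integrable f π := by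
      have := hm.integrable.add (integrable_const m)
      refine this.congr (Filter.Eventually.of_forall fun x => ?_)
      simp
    have hmean : ∫ y, f y ∂π = m := by
      have h1 : ∫ y, (f y - m) ∂π = 0 := h0
      rw [integral_sub h_integ (integrable_const m)] at h1
      simp at h1
      linarith
    have hb := hm.measure_ge_le ht.le
    rw [hmean]
    rw [← ENNReal.ofReal_toReal (measure_ne_top π _)]
    exact ENNReal.ofReal_le_ofReal hb
  · intro F g hF hlim
    exact subG_limit π c (fun k x => F k (WithLp.toLp 2 x)) (fun x => g (WithLp.toLp 2 x)) hF
      (fun x => hlim _)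
  · rintro F hF ⟨M, hM⟩ hFL
    have hsm : ContDiff ℝ (⊤ : ℕ∞) (fun x : Fin n → E => F (WithLp.toLp 2 x)) :=
      hF.comp (PiLp.continuousLinearEquiv 2 ℝ (fun _ : Fin n => E)).symm.contDiff
    refine ⟨_, herbst π (fun x : Fin n → E => F (WithLp.toLp 2 x)) hsm.continuous.measurable M
      (fun x => hM _) c fun l => ?_⟩
    refine ent_smooth μ C hC hLS L hL _ hsm M (fun x => hM _) (fun x y => ?_) l
    have := hFL (WithLp.toLp 2 x) (WithLp.toLp 2 y)
    rw [PiLp.norm_eq_of_L2] at this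
    simpa using this
  · intro x y
    have := hf (WithLp.ofLp x) (WithLp.ofLp y)
    rw [PiLp.norm_eq_of_L2]
    simpa using this

lemma glue_exists {E : Type*} [NormedAddCommGroup E] [MeasurableSpace E] [BorelSpace E]
    {n : ℕ} (hn : 0 < n) (y : Fin n → E) (ξ : Measure (E × E))
    (hξ : ξ.map Prod.fst = empiricalMeasure y) :
    ∃ η : Measure (Fin n × E), η.map Prod.fst = (n : ℝ≥0∞)⁻¹ • ∑ i, Measure.dirac i ∧
      η.map (fun q => (y q.1, q.2)) = ξ := by
  classical
  set cd : E → ℝ≥0∞ := fun z => ((Finset.univ.filter fun j => y j = z).card : ℝ≥0∞) with hcd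
  have hn0 : (n : ℝ≥0∞) ≠ 0 := by exact_mod_cast hn.ne'
  have hcdpos : ∀ i, cd (y i) ≠ 0 := by
    intro i
    simp only [hcd]
    have : 0 < (Finset.univ.filter fun j => y j = y i).card :=
      Finset.card_pos.2 ⟨i, by simp⟩
    exact_mod_cast this.ne'
  have hcdtop : ∀ z, cd z ≠ ⊤ := fun z => ENNReal.natCast_ne_top _
  have hS : ∀ z : E, MeasurableSet (Prod.fst ⁻¹' {z} : Set (E × E)) := fun z =>
    measurable_fst (measurableSet_singleton z)
  have hem : ∀ z, ξ (Prod.fst ⁻¹' {z}) = (n : ℝ≥0∞)⁻¹ * cd z := by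
    intro z
    rw [← Measure.map_apply measurable_fst (measurableSet_singleton z), hξ]
    simp [empiricalMeasure, hcd, Measure.dirac_apply' _ (measurableSet_singleton z),
      Set.indicator_apply, Finset.sum_boole]
  have hsupp : ξ (Prod.fst ⁻¹' (↑(Finset.univ.image y) : Set E))ᶜ = 0 := by
    have hms : MeasurableSet (↑(Finset.univ.image y) : Set E) := Finset.measurableSet _
    rw [← Set.preimage_compl, ← Measure.map_apply measurable_fst hms.compl, hξ]
    simp [empiricalMeasure, Measure.dirac_apply' _ hms.compl]
  have hmi : ∀ i : Fin n, Measurable (fun q : E × E => (i, q.2)) := fun i => by fun_prop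
  have hmy : Measurable (fun q : Fin n × E => (y q.1, q.2)) := by
    have : Measurable y := measurable_of_countable y
    fun_prop
  refine ⟨∑ i, (cd (y i))⁻¹ • (ξ.restrict (Prod.fst ⁻¹' {y i})).map (fun q => (i, q.2)), ?_, ?_⟩
  · rw [Measure.map_finset_sum measurable_fst.aemeasurable, Finset.smul_sum]
    refine Finset.sum_congr rfl fun i _ => ?_
    rw [Measure.map_smul, Measure.map_map measurable_fst (hmi i)]
    have : (Prod.fst ∘ fun q : E × E => (i, q.2)) = fun _ => i := rfl
    rw [this, Measure.map_const, Measure.restrict_apply_univ, hem, smul_smul]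
    congr 1
    rw [mul_comm, mul_assoc, ENNReal.mul_inv_cancel (hcdpos i) (hcdtop _), mul_one]
  · rw [Measure.map_finset_sum hmy.aemeasurable]
    have e1 : ∀ i, ((cd (y i))⁻¹ • (ξ.restrict (Prod.fst ⁻¹' {y i})).map (fun q => (i, q.2))).map
        (fun q => (y q.1, q.2)) = (cd (y i))⁻¹ • ξ.restrict (Prod.fst ⁻¹' {y i}) := by
      intro i
      rw [Measure.map_smul, Measure.map_map hmy (hmi i)]
      congr 1
      have : ((fun q : Fin n × E => (y q.1, q.2)) ∘ fun q : E × E => (i, q.2))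
          =ᵐ[ξ.restrict (Prod.fst ⁻¹' {y i})] id := by
        filter_upwards [ae_restrict_mem (hS (y i))] with q hq
        simp at hq
        simp [← hq]
      rw [Measure.map_congr this, Measure.map_id]
    simp_rw [e1]
    ext A hA
    simp only [Measure.coe_finset_sum, Finset.sum_apply, Measure.smul_apply, smul_eq_mul]
    have e2 := Finset.sum_comp (s := Finset.univ) (fun z : E => (cd z)⁻¹ *
      ξ.restrict (Prod.fst ⁻¹' {z}) A) y
    rw [e2]
    have e3 : ∀ b ∈ Finset.univ.image y, (Finset.univ.filter fun a => y a = b).card •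
        ((cd b)⁻¹ * ξ.restrict (Prod.fst ⁻¹' {b}) A) = (ξ.restrict A) (Prod.fst ⁻¹' {b}) := by
      intro b hb
      obtain ⟨i, _, rfl⟩ := Finset.mem_image.1 hb
      rw [nsmul_eq_mul, ← mul_assoc]
      change cd (y i) * (cd (y i))⁻¹ * _ = _
      rw [ENNReal.mul_inv_cancel (hcdpos i) (hcdtop _), one_mul, Measure.restrict_apply hA,
        Measure.restrict_apply (hS _), Set.inter_comm]
    rw [Finset.sum_congr rfl e3, sum_measure_preimage_singleton _ (fun b _ => hS b)]
    have hms : MeasurableSet (Prod.fst ⁻¹' (↑(Finset.univ.image y) : Set E) : Set (E × E)) :=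
      measurable_fst (Finset.measurableSet _)
    rw [Measure.restrict_apply hms, Set.inter_comm]
    exact measure_inter_conull hsupp

lemma real_pmean {n : ℕ} (hn : 0 < n) (p : ℝ) (hp : 1 ≤ p) (a : Fin n → ℝ) (ha : ∀ i, 0 ≤ a i) :
    (∑ i, (n : ℝ)⁻¹ * a i ^ p) ^ (1 / p) ≤
      (n : ℝ) ^ (-(1 / max 2 p)) * Real.sqrt (∑ i, a i ^ 2) := by
  have hnp : (0 : ℝ) < n := by exact_mod_cast hn
  have hp0 : 0 < p := by linarith
  have hsum0 : 0 ≤ ∑ i, (n : ℝ)⁻¹ * a i ^ p := Finset.sum_nonneg fun i _ =>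
    mul_nonneg (by positivity) (Real.rpow_nonneg (ha i) _)
  have hs0 : 0 ≤ ∑ i, a i ^ 2 := Finset.sum_nonneg fun i _ => sq_nonneg _
  rcases le_total p 2 with h | h
  · rw [max_eq_left h]
    have h1 := Real.rpow_arith_mean_le_arith_mean_rpow Finset.univ (fun _ : Fin n => (n : ℝ)⁻¹)
      (fun i => a i ^ p) (fun _ _ => by positivity) (by simp [hnp.ne'])
      (fun i _ => Real.rpow_nonneg (ha i) _) (p := 2 / p) (by rw [le_div_iff₀ hp0]; linarith)
    have h2 : ∀ i, (a i ^ p) ^ (2 / p) = a i ^ 2 := by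
      intro i
      rw [← Real.rpow_mul (ha i), mul_div_cancel₀ _ hp0.ne', Real.rpow_two]
    simp only [h2] at h1
    rw [← Finset.mul_sum (f := fun i => a i ^ 2)] at h1
    have h3 : (∑ i, (n : ℝ)⁻¹ * a i ^ p) ^ (1 / p) =
        ((∑ i, (n : ℝ)⁻¹ * a i ^ p) ^ (2 / p)) ^ (1 / 2 : ℝ) := by
      rw [← Real.rpow_mul hsum0]; congr 1; ring
    rw [h3]
    refine (Real.rpow_le_rpow (Real.rpow_nonneg hsum0 _) h1 (by norm_num)).trans (le_of_eq ?_)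
    rw [Real.mul_rpow (by positivity) hs0, Real.sqrt_eq_rpow, Real.inv_rpow hnp.le,
      Real.rpow_neg hnp.le]
  · rw [max_eq_right h]
    set s := Real.sqrt (∑ i, a i ^ 2) with hs
    have hss : s ^ 2 = ∑ i, a i ^ 2 := Real.sq_sqrt hs0
    have hsn : 0 ≤ s := Real.sqrt_nonneg _
    have hle : ∀ i, a i ≤ s := fun i => by
      refine Real.le_sqrt_of_sq_le ?_
      exact Finset.single_le_sum (f := fun i => a i ^ 2) (fun _ _ => sq_nonneg _) (Finset.mem_univ i)
    have hsplit : ∀ b : ℝ, 0 ≤ b → b ^ p = b ^ 2 * b ^ (p - 2) := by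
      intro b hb
      rw [← Real.rpow_two, ← Real.rpow_add_of_nonneg hb (by norm_num) (by linarith)]
      congr 1; ring
    have h1 : ∑ i, a i ^ p ≤ s ^ p := by
      rw [hsplit s hsn, hss, Finset.sum_mul]
      refine Finset.sum_le_sum fun i _ => ?_
      rw [hsplit _ (ha i)]
      exact mul_le_mul_of_nonneg_left (Real.rpow_le_rpow (ha i) (hle i) (by linarith)) (sq_nonneg _)
    rw [← Finset.mul_sum] at hsum0 ⊢
    have h2 : (n : ℝ)⁻¹ * ∑ i, a i ^ p ≤ (n : ℝ)⁻¹ * s ^ p := by gcongr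
    refine (Real.rpow_le_rpow hsum0 h2 (by positivity)).trans (le_of_eq ?_)
    rw [Real.mul_rpow (by positivity) (Real.rpow_nonneg hsn _), ← Real.rpow_mul hsn,
      mul_one_div_cancel hp0.ne', Real.rpow_one, Real.inv_rpow hnp.le, Real.rpow_neg hnp.le]

lemma wass_step {E : Type*} [NormedAddCommGroup E] [MeasurableSpace E] [BorelSpace E]
    [SecondCountableTopology E] (μ : Measure E) (p : ℝ) (hp : 1 ≤ p) {n : ℕ} (hn : 0 < n)
    (x y : Fin n → E) :
    (⨅ ξ ∈ {ξ : Measure (E × E) | ξ.map Prod.fst = empiricalMeasure x ∧ ξ.map Prod.snd = μ},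
      ∫⁻ q, ENNReal.ofReal (‖q.1 - q.2‖ ^ p) ∂ξ) ^ (1 / p) ≤
    ENNReal.ofReal ((n : ℝ) ^ (-(1 / max 2 p)) * Real.sqrt (∑ i, ‖x i - y i‖ ^ 2)) +
    (⨅ ξ ∈ {ξ : Measure (E × E) | ξ.map Prod.fst = empiricalMeasure y ∧ ξ.map Prod.snd = μ},
      ∫⁻ q, ENNReal.ofReal (‖q.1 - q.2‖ ^ p) ∂ξ) ^ (1 / p) := by
  have hp0 : 0 < p := by linarith
  set I := ⨅ ξ ∈ {ξ : Measure (E × E) | ξ.map Prod.fst = empiricalMeasure x ∧ ξ.map Prod.snd = μ},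
      ∫⁻ q, ENNReal.ofReal (‖q.1 - q.2‖ ^ p) ∂ξ with hI
  set D := ENNReal.ofReal ((n : ℝ) ^ (-(1 / max 2 p)) * Real.sqrt (∑ i, ‖x i - y i‖ ^ 2)) with hD
  have hcm : Measurable (fun q : E × E => ENNReal.ofReal (‖q.1 - q.2‖ ^ p)) := by fun_prop
  have hmain : ∀ ξ ∈ {ξ : Measure (E × E) | ξ.map Prod.fst = empiricalMeasure y ∧
      ξ.map Prod.snd = μ}, I ^ (1 / p) ≤ D +
      (∫⁻ q, ENNReal.ofReal (‖q.1 - q.2‖ ^ p) ∂ξ) ^ (1 / p) := by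
    rintro ξ ⟨hξ1, hξ2⟩
    obtain ⟨η, hη1, hη2⟩ := glue_exists hn y ξ hξ1
    have hmx : Measurable x := measurable_of_countable x
    have hmy : Measurable y := measurable_of_countable y
    have hmx' : Measurable (fun q : Fin n × E => (x q.1, q.2)) := by fun_prop
    have hmy' : Measurable (fun q : Fin n × E => (y q.1, q.2)) := by fun_prop
    have hc1 : (η.map (fun q => (x q.1, q.2))).map Prod.fst = empiricalMeasure x := by
      rw [Measure.map_map measurable_fst hmx']
      have : (Prod.fst ∘ fun q : Fin n × E => (x q.1, q.2)) = x ∘ Prod.fst := rfl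
      rw [this, ← Measure.map_map hmx measurable_fst, hη1, Measure.map_smul,
        Measure.map_finset_sum hmx.aemeasurable]
      simp [empiricalMeasure, Measure.map_dirac' hmx]
    have hc2 : (η.map (fun q => (x q.1, q.2))).map Prod.snd = μ := by
      rw [← hξ2, ← hη2, Measure.map_map measurable_snd hmx', Measure.map_map measurable_snd hmy']
      rfl
    have hle : I ≤ ∫⁻ q, ENNReal.ofReal (‖q.1 - q.2‖ ^ p) ∂(η.map (fun q => (x q.1, q.2))) :=
      iInf₂_le _ ⟨hc1, hc2⟩
    rw [lintegral_map hcm hmx'] at hle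
    rw [← hη2, lintegral_map hcm hmy']
    have hpow : ∀ v : E, ENNReal.ofReal (‖v‖ ^ p) = ENNReal.ofReal ‖v‖ ^ p := fun v =>
      (ENNReal.ofReal_rpow_of_nonneg (norm_nonneg v) hp0.le).symm
    have hfm : Measurable (fun q : Fin n × E => ENNReal.ofReal ‖x q.1 - y q.1‖) := by fun_prop
    have hgm : Measurable (fun q : Fin n × E => ENNReal.ofReal ‖y q.1 - q.2‖) := by fun_prop
    have hmink := ENNReal.lintegral_Lp_add_le (μ := η) hfm.aemeasurable hgm.aemeasurable hp
    have hb : I ≤ ∫⁻ q : Fin n × E, (((fun q : Fin n × E => ENNReal.ofReal ‖x q.1 - y q.1‖) +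
        (fun q : Fin n × E => ENNReal.ofReal ‖y q.1 - q.2‖)) q) ^ p ∂η := by
      refine hle.trans (lintegral_mono fun q => ?_)
      simp only [Pi.add_apply]
      rw [hpow]
      refine ENNReal.rpow_le_rpow ?_ hp0.le
      rw [← ENNReal.ofReal_add (norm_nonneg _) (norm_nonneg _)]
      exact ENNReal.ofReal_le_ofReal (norm_sub_le_norm_sub_add_norm_sub _ _ _)
    refine (ENNReal.rpow_le_rpow hb (by positivity)).trans (hmink.trans ?_)
    refine add_le_add ?_ (le_of_eq ?_)
    · have e : ∫⁻ q : Fin n × E, ENNReal.ofReal ‖x q.1 - y q.1‖ ^ p ∂η =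
          ENNReal.ofReal (∑ i, (n : ℝ)⁻¹ * ‖x i - y i‖ ^ p) := by
        have h1 : ∫⁻ q : Fin n × E, ENNReal.ofReal ‖x q.1 - y q.1‖ ^ p ∂η =
            ∫⁻ i, ENNReal.ofReal ‖x i - y i‖ ^ p ∂(η.map Prod.fst) :=
          (lintegral_map (μ := η) (f := fun i : Fin n => ENNReal.ofReal ‖x i - y i‖ ^ p)
            (g := Prod.fst) (measurable_of_countable _) measurable_fst).symm
        rw [h1, hη1, lintegral_smul_measure, lintegral_finset_sum_measure]
        rw [ENNReal.ofReal_sum_of_nonneg (fun i _ => by positivity), smul_eq_mul, Finset.mul_sum]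
        refine Finset.sum_congr rfl fun i _ => ?_
        rw [lintegral_dirac, ENNReal.ofReal_mul (by positivity), hpow,
          ENNReal.ofReal_inv_of_pos (by exact_mod_cast hn), ENNReal.ofReal_natCast]
      rw [e, ENNReal.ofReal_rpow_of_nonneg (Finset.sum_nonneg fun i _ => by positivity)
        (by positivity)]
      exact ENNReal.ofReal_le_ofReal (real_pmean hn p hp _ fun i => norm_nonneg _)
    · simp only [hpow]
  have h3 : (I ^ (1 / p) - D) ^ p ≤ ⨅ ξ ∈ {ξ : Measure (E × E) | ξ.map Prod.fst =
      empiricalMeasure y ∧ ξ.map Prod.snd = μ}, ∫⁻ q, ENNReal.ofReal (‖q.1 - q.2‖ ^ p) ∂ξ := by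
    refine le_iInf₂ fun ξ hξ => ?_
    have := tsub_le_iff_left.2 (hmain ξ hξ)
    have := ENNReal.rpow_le_rpow this hp0.le
    rwa [← ENNReal.rpow_mul, one_div_mul_cancel hp0.ne', ENNReal.rpow_one] at this
  have h4 := ENNReal.rpow_le_rpow h3 (show 0 ≤ 1 / p by positivity)
  rw [← ENNReal.rpow_mul, mul_one_div_cancel hp0.ne', ENNReal.rpow_one] at h4
  exact tsub_le_iff_left.1 h4

lemma wass_lip {E : Type*} [NormedAddCommGroup E] [MeasurableSpace E] [BorelSpace E]
    [SecondCountableTopology E] (μ : Measure E) (p : ℝ) (hp : 1 ≤ p) {n : ℕ} (hn : 0 < n)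
    (x y : Fin n → E) :
    wassersteinDist p (empiricalMeasure x) μ ≤ wassersteinDist p (empiricalMeasure y) μ +
      (n : ℝ) ^ (-(1 / max 2 p)) * Real.sqrt (∑ i, ‖x i - y i‖ ^ 2) := by
  have h1 := wass_step μ p hp hn x y
  have h2 := wass_step μ p hp hn y x
  have hd0 : 0 ≤ (n : ℝ) ^ (-(1 / max 2 p)) * Real.sqrt (∑ i, ‖x i - y i‖ ^ 2) := by positivity
  unfold wassersteinDist
  set a := (⨅ ξ ∈ {ξ : Measure (E × E) | ξ.map Prod.fst = empiricalMeasure x ∧ ξ.map Prod.snd = μ},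
      ∫⁻ q, ENNReal.ofReal (‖q.1 - q.2‖ ^ p) ∂ξ) ^ (1 / p)
  set b := (⨅ ξ ∈ {ξ : Measure (E × E) | ξ.map Prod.fst = empiricalMeasure y ∧ ξ.map Prod.snd = μ},
      ∫⁻ q, ENNReal.ofReal (‖q.1 - q.2‖ ^ p) ∂ξ) ^ (1 / p)
  by_cases hb : b = ⊤
  · have ha : a = ⊤ := by
      by_contra ha
      rw [hb, top_le_iff] at h2
      exact ENNReal.add_ne_top.2 ⟨ENNReal.ofReal_ne_top, ha⟩ h2
    rw [ha, hb]; simpa using hd0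
  · have := ENNReal.toReal_mono (ENNReal.add_ne_top.2 ⟨ENNReal.ofReal_ne_top, hb⟩) h1
    rw [ENNReal.toReal_add ENNReal.ofReal_ne_top hb, ENNReal.toReal_ofReal hd0] at this
    linarith

/-- concentration from a log Sobolev inequality:
if `μ` satisfies a log Sobolev inequality with constant `C` and
`f : Xⁿ → ℝ` is `n^{−1/max(2,p)}`-Lipschitz for the ℓ² product norm, then
`P(f − E f ≥ t) ≤ exp(−n^{2/max(2,p)} t²/(2C))` under the product measure; in
particular this holds for `f(x) = W_p(μ̂_x, μ)`. -/
theorem log_sobolev_wasserstein_concentration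
    {E : Type*} [NormedAddCommGroup E] [NormedSpace ℝ E] [MeasurableSpace E]
    [BorelSpace E] [SecondCountableTopology E]
    (μ : Measure E) [IsProbabilityMeasure μ]
    (C : ℝ) (hC : 0 < C) (hLS : LogSobolev μ C)
    (p : ℝ) (hp : 1 ≤ p) {n : ℕ} (hn : 0 < n)
    (f : (Fin n → E) → ℝ) (hfm : Measurable f)
    (hf : ∀ x y : Fin n → E,
      |f x - f y| ≤ (n : ℝ) ^ (-(1 / max 2 p)) * Real.sqrt (∑ i, ‖x i - y i‖ ^ 2))
    (t : ℝ) (ht : 0 < t) :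
    (Measure.pi fun _ : Fin n => μ)
        {x | t ≤ f x - ∫ y, f y ∂(Measure.pi fun _ : Fin n => μ)}
      ≤ ENNReal.ofReal (Real.exp (-((n : ℝ) ^ ((2:ℝ) / max 2 p) * t ^ 2) / (2 * C)))
    ∧ (Measure.pi fun _ : Fin n => μ)
        {x | t ≤ wassersteinDist p (empiricalMeasure x) μ
              - ∫ y, wassersteinDist p (empiricalMeasure y) μ
                  ∂(Measure.pi fun _ : Fin n => μ)}
      ≤ ENNReal.ofReal (Real.exp (-((n : ℝ) ^ ((2:ℝ) / max 2 p) * t ^ 2) / (2 * C))) := by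
  have hn' : (0 : ℝ) < n := by exact_mod_cast hn
  have hL : 0 ≤ (n : ℝ) ^ (-(1 / max 2 p)) := by positivity
  have e : -t ^ 2 / (2 * (C * ((n : ℝ) ^ (-(1 / max 2 p))) ^ 2)) =
      -((n : ℝ) ^ ((2:ℝ) / max 2 p) * t ^ 2) / (2 * C) := by
    have h1 : ((n : ℝ) ^ (-(1 / max 2 p))) ^ 2 = ((n : ℝ) ^ ((2:ℝ) / max 2 p))⁻¹ := by
      rw [← Real.rpow_natCast, ← Real.rpow_mul hn'.le, ← Real.rpow_neg hn'.le]
      congr 1; push_cast; ring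
    rw [h1]
    have : 0 < (n : ℝ) ^ ((2:ℝ) / max 2 p) := by positivity
    field_simp
  rw [← e]
  constructor
  · refine lip_concentration μ C hC hLS _ hL f (fun x y => ?_) t ht
    linarith [(le_abs_self _).trans (hf x y)]
  · exact lip_concentration μ C hC hLS _ hL
      (fun x => wassersteinDist p (empiricalMeasure x) μ) (wass_lip μ p hp hn) t ht
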